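/- arXiv:2010.14088 — 2 statements merged into one kernel-verified Lean document; each statement's English description precedes it below -/
import Mathlib

section
/- Let A ∈ ℝ^{n×n} be symmetric positive definite, let ρ_A > 0 and c_s > 0, and let B ∈ ℝ^{n×n} be symmetric positive semidefinite with B A B = B. Suppose w ∈ ℝⁿ and r = A w satisfy ‖r‖² ≤ c_s ρ_A rᵀ B r. Then ‖(I − B A) w‖_A² ≤ ‖w‖_A² − c_s⁻¹ ρ_A⁻¹ ‖A w‖², where ‖A w‖² = wᵀ A² w. -/
open Matrix

/-- A symmetric matrix can be moved across the dot product. -/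
theorem Matrix.IsSymm.dotProduct_mulVec_comm {m R : Type*} [Fintype m] [CommSemiring R]
    {M : Matrix m m R} (hM : M.IsSymm) (x y : m → R) :
    x ⬝ᵥ (M *ᵥ y) = (M *ᵥ x) ⬝ᵥ y := by
  rw [dotProduct_mulVec, ← mulVec_transpose, hM.eq]

/-- If `B * A * B = B`, the correction `w ↦ (1 - B * A) w` lowers the energy `wᵀ A w` by exactly
`rᵀ B r`, where `r = A w`. -/
theorem dotProduct_mulVec_one_sub_mul {m R : Type*} [Fintype m] [DecidableEq m] [CommRing R]
    {A B : Matrix m m R} (hA : A.IsSymm) (hB : B.IsSymm) (hBAB : B * A * B = B) (w : m → R) :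
    ((1 - B * A) *ᵥ w) ⬝ᵥ (A *ᵥ ((1 - B * A) *ᵥ w)) =
      w ⬝ᵥ (A *ᵥ w) - (A *ᵥ w) ⬝ᵥ (B *ᵥ (A *ᵥ w)) := by
  have hcross : w ⬝ᵥ (A *ᵥ (B *ᵥ (A *ᵥ w))) = (A *ᵥ w) ⬝ᵥ (B *ᵥ (A *ᵥ w)) :=
    hA.dotProduct_mulVec_comm _ _
  have hquad : (B *ᵥ (A *ᵥ w)) ⬝ᵥ (A *ᵥ (B *ᵥ (A *ᵥ w))) = (A *ᵥ w) ⬝ᵥ (B *ᵥ (A *ᵥ w)) := by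
    rw [← hB.dotProduct_mulVec_comm, mulVec_mulVec (A *ᵥ w) A B,
      mulVec_mulVec (A *ᵥ w) B (A * B), ← Matrix.mul_assoc, hBAB]
  rw [sub_mulVec, one_mulVec, ← mulVec_mulVec, mulVec_sub, sub_dotProduct, dotProduct_sub,
    dotProduct_sub, hcross, hquad, dotProduct_comm (B *ᵥ (A *ᵥ w)) (A *ᵥ w)]
  ring

/-- Quantitative smoothing estimate:
`‖(I − B A) w‖_A² ≤ ‖w‖_A² − c_s⁻¹ ρ_A⁻¹ ‖A w‖²` under the smoother
assumption `‖r‖² ≤ c_s ρ_A rᵀ B r` with `r = A w`. -/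
theorem smoothing_quantitative_estimate {n : ℕ}
    (A B : Matrix (Fin n) (Fin n) ℝ)
    (hA : A.PosDef) (ρ cs : ℝ) (hρ : 0 < ρ) (hcs : 0 < cs)
    (hB : B.PosSemidef) (hBAB : B * A * B = B)
    (w r : Fin n → ℝ) (hr : r = A *ᵥ w)
    (hsm : r ⬝ᵥ r ≤ cs * ρ * (r ⬝ᵥ (B *ᵥ r))) :
    ((1 - B * A) *ᵥ w) ⬝ᵥ (A *ᵥ ((1 - B * A) *ᵥ w)) ≤
      w ⬝ᵥ (A *ᵥ w) - cs⁻¹ * ρ⁻¹ * ((A *ᵥ w) ⬝ᵥ (A *ᵥ w)) := by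
  subst hr
  have hdiv : cs⁻¹ * ρ⁻¹ * ((A *ᵥ w) ⬝ᵥ (A *ᵥ w)) ≤ (A *ᵥ w) ⬝ᵥ (B *ᵥ (A *ᵥ w)) := by
    rw [← mul_inv]
    exact (inv_mul_le_iff₀ (mul_pos hcs hρ)).mpr hsm
  rw [dotProduct_mulVec_one_sub_mul (isHermitian_iff_isSymm.mp hA.isHermitian)
    (isHermitian_iff_isSymm.mp hB.isHermitian) hBAB]
  linarith
end

section
/- Let A ∈ ℝ^{n×n} be symmetric positive definite and let ρ_A > 0 satisfy vᵀ A v ≤ ρ_A ‖v‖² for all v ∈ ℝⁿ (e.g. ρ_A is the spectral radius of A). Let r ∈ ℝⁿ with r ≠ 0, and let G = (g₁, …, g_L) ∈ ℝ^{n×L} have A-orthonormal columns (gᵢᵀ A gⱼ = δ_{ij}) with first column g₁ = r / ‖r‖_A. Then the subspace-correction smoother B = G (Gᵀ A G)⁻¹ Gᵀ satisfies ‖r‖² ≤ ρ_A rᵀ B r; i.e., the smoother assumption ‖r‖² ≤ c_s ρ_A rᵀ B r holds with c_s = 1. -/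
open Matrix

/-- If the columns of `G` are `A`-orthonormal with first column `r / ‖r‖_A`,
then the subspace-correction smoother `B = G (Gᵀ A G)⁻¹ Gᵀ` satisfies the key
smoother assumption `‖r‖² ≤ ρ_A rᵀ B r` (i.e. with constant `c_s = 1`). -/
theorem subspace_correction_smoother_assumption {n L : ℕ} (hL : 0 < L)
    (A : Matrix (Fin n) (Fin n) ℝ) (hA : A.PosDef)
    (ρ : ℝ) (hρ : 0 < ρ) (hρA : ∀ v : Fin n → ℝ, v ⬝ᵥ (A *ᵥ v) ≤ ρ * (v ⬝ᵥ v))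
    (r : Fin n → ℝ) (hr : r ≠ 0)
    (G : Matrix (Fin n) (Fin L) ℝ)
    (hGorth : ∀ i j : Fin L, (Gᵀ i) ⬝ᵥ (A *ᵥ (Gᵀ j)) = if i = j then 1 else 0)
    (hG1 : Gᵀ ⟨0, hL⟩ = (Real.sqrt (r ⬝ᵥ (A *ᵥ r)))⁻¹ • r) :
    r ⬝ᵥ r ≤ ρ * (r ⬝ᵥ ((G * (Gᵀ * A * G)⁻¹ * Gᵀ) *ᵥ r)) := by
  have hGram : Gᵀ * A * G = 1 := by
    ext i j
    rw [Matrix.mul_assoc, Matrix.one_apply, ← hGorth i j]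
    rfl
  have ha : 0 < r ⬝ᵥ (A *ᵥ r) := by
    simpa using hA.dotProduct_mulVec_pos hr
  have hrr : 0 ≤ r ⬝ᵥ r := Finset.sum_nonneg fun i _ => mul_self_nonneg (r i)
  have hB : r ⬝ᵥ ((G * (Gᵀ * A * G)⁻¹ * Gᵀ) *ᵥ r) = (Gᵀ *ᵥ r) ⬝ᵥ (Gᵀ *ᵥ r) := by
    rw [hGram, inv_one, Matrix.mul_one, ← Matrix.mulVec_mulVec, Matrix.dotProduct_mulVec,
      Matrix.mulVec_transpose]
  have hfirst : (Gᵀ *ᵥ r) ⟨0, hL⟩ = (Real.sqrt (r ⬝ᵥ (A *ᵥ r)))⁻¹ * (r ⬝ᵥ r) := by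
    change Gᵀ ⟨0, hL⟩ ⬝ᵥ r = _
    rw [hG1, smul_dotProduct, smul_eq_mul]
  have hle : (r ⬝ᵥ r) ^ 2 / (r ⬝ᵥ (A *ᵥ r)) ≤ (Gᵀ *ᵥ r) ⬝ᵥ (Gᵀ *ᵥ r) := by
    calc (r ⬝ᵥ r) ^ 2 / (r ⬝ᵥ (A *ᵥ r))
        = (Gᵀ *ᵥ r) ⟨0, hL⟩ * (Gᵀ *ᵥ r) ⟨0, hL⟩ := by
          rw [hfirst, ← sq, mul_pow, inv_pow, Real.sq_sqrt ha.le, div_eq_inv_mul]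
      _ ≤ (Gᵀ *ᵥ r) ⬝ᵥ (Gᵀ *ᵥ r) :=
          Finset.single_le_sum (f := fun i => (Gᵀ *ᵥ r) i * (Gᵀ *ᵥ r) i)
            (fun i _ => mul_self_nonneg _) (Finset.mem_univ _)
  rw [hB]
  refine le_trans ?_ (mul_le_mul_of_nonneg_left hle hρ.le)
  rw [← mul_div_assoc, le_div_iff₀ ha]
  calc (r ⬝ᵥ r) * (r ⬝ᵥ (A *ᵥ r)) ≤ (r ⬝ᵥ r) * (ρ * (r ⬝ᵥ r)) :=
        mul_le_mul_of_nonneg_left (hρA r) hrr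
    _ = ρ * (r ⬝ᵥ r) ^ 2 := by ring
end
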